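/- The sumset U₀ + U₀ + U equals ℕ \ {0, 1, 3, 8}; that is, a natural number n can be written as n = a + b + c with a, b ∈ U₀ and c ∈ U if and only if n ∉ {0, 1, 3, 8}. -/

import Mathlib

noncomputable def phi : ℝ := (1 + Real.sqrt 5) / 2

/-- The lower Wythoff set `L = {⌊i·φ⌋ : i ≥ 1}`. -/
def lowerWythoff : Set ℕ := {n | ∃ i : ℕ, 1 ≤ i ∧ n = ⌊(i : ℝ) * phi⌋₊}

/-- The upper Wythoff set `U = {⌊i·φ²⌋ : i ≥ 1}`. -/
def upperWythoff : Set ℕ := {n | ∃ i : ℕ, 1 ≤ i ∧ n = ⌊(i : ℝ) * phi ^ 2⌋₊}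

theorem phi_sq : phi ^ 2 = phi + 1 := Real.goldenRatio_sq

theorem irrational_phi : Irrational phi := Real.goldenRatio_irrational

theorem phi_gt : 1.618 < phi := by
  have h : (2.236 : ℝ) < Real.sqrt 5 := Real.lt_sqrt_of_sq_lt (by norm_num)
  unfold phi
  linarith

theorem phi_lt : phi < 1.6181 := by
  have h : Real.sqrt 5 < (2.2362 : ℝ) := (Real.sqrt_lt' (by norm_num)).2 (by norm_num)
  unfold phi
  linarith

/-- A positive integer whose multiple of `phi` has fractional part in `(0, 2 - phi)` is an upper
Wythoff number. -/
theorem mem_upperWythoff_of_fract {m : ℕ} (hm : 1 ≤ m) (j : ℤ) (h₀ : 0 < m * phi - j)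
    (h₁ : m * phi - j < 2 - phi) : m ∈ upperWythoff := by
  have hg := phi_gt
  have hl := phi_lt
  have hsq := phi_sq
  have hm' : (1 : ℝ) ≤ m := by exact_mod_cast hm
  have hi : (0 : ℝ) < ((2 * m - j : ℤ) : ℝ) := by
    push_cast
    nlinarith
  have hi' : 0 < 2 * (m : ℤ) - j := by exact_mod_cast hi
  obtain ⟨i, hij⟩ := Int.eq_ofNat_of_zero_le hi'.le
  have hir : (i : ℝ) = 2 * m - j := by
    have h : ((2 * (m : ℤ) - j : ℤ) : ℝ) = ((i : ℤ) : ℝ) := congrArg _ hij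
    push_cast at h
    exact h.symm
  have key : (i : ℝ) * phi ^ 2 = m + (m * phi - j) * phi ^ 2 := by
    rw [hir]
    linear_combination (2 * m - m * phi) * hsq - m * hsq
  refine ⟨i, by omega, ((Nat.floor_eq_iff (by positivity)).2 ⟨?_, ?_⟩).symm⟩
  · rw [key]
    have : 0 < (m * phi - j) * phi ^ 2 := by positivity
    linarith
  · rw [key]
    have h : (m * phi - j) * phi ^ 2 < (2 - phi) * phi ^ 2 := by gcongr
    have h' : (2 - phi) * phi ^ 2 = 1 := by linear_combination (1 - phi) * hsq
    linarith

theorem eq_or_ten_le_of_mem_upperWythoff {m : ℕ} (hm : m ∈ upperWythoff) :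
    m = 2 ∨ m = 5 ∨ m = 7 ∨ 10 ≤ m := by
  obtain ⟨i, hi, rfl⟩ := hm
  have hg := phi_gt
  have hl := phi_lt
  rw [phi_sq]
  obtain rfl | rfl | rfl | h : i = 1 ∨ i = 2 ∨ i = 3 ∨ 4 ≤ i := by omega
  · left
    rw [Nat.floor_eq_iff (by positivity)]
    constructor <;> norm_num <;> linarith
  · right; left
    rw [Nat.floor_eq_iff (by positivity)]
    constructor <;> norm_num <;> linarith
  · right; right; left
    rw [Nat.floor_eq_iff (by positivity)]
    constructor <;> norm_num <;> linarith
  · right; right; right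
    apply Nat.le_floor
    have h4 : (4 : ℝ) ≤ i := by exact_mod_cast h
    push_cast
    nlinarith

theorem two_mem_upperWythoff : 2 ∈ upperWythoff := by
  have hg := phi_gt
  have hl := phi_lt
  refine mem_upperWythoff_of_fract (by norm_num) 3 ?_ ?_ <;> push_cast <;> linarith

theorem five_mem_upperWythoff : 5 ∈ upperWythoff := by
  have hg := phi_gt
  have hl := phi_lt
  refine mem_upperWythoff_of_fract (by norm_num) 8 ?_ ?_ <;> push_cast <;> linarith

theorem seven_mem_upperWythoff : 7 ∈ upperWythoff := by
  have hg := phi_gt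
  have hl := phi_lt
  refine mem_upperWythoff_of_fract (by norm_num) 11 ?_ ?_ <;> push_cast <;> linarith

theorem thirteen_mem_upperWythoff : 13 ∈ upperWythoff := by
  have hg := phi_gt
  have hl := phi_lt
  refine mem_upperWythoff_of_fract (by norm_num) 21 ?_ ?_ <;> push_cast <;> linarith

/-- The arcs of the circle belonging to the shifts `0`, `2`, `4` and `14` cover everything. -/
theorem exists_sub_mem_upperWythoff {n : ℕ} (hn : 15 ≤ n) :
    n ∈ upperWythoff ∨ n - 2 ∈ upperWythoff ∨ n - 4 ∈ upperWythoff ∨ n - 14 ∈ upperWythoff := by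
  have hg := phi_gt
  have hl := phi_lt
  have hlt : (⌊n * phi⌋ : ℝ) < n * phi :=
    lt_of_le_of_ne (Int.floor_le _) ((irrational_phi.natCast_mul (by omega)).ne_int _).symm
  have hub := Int.lt_floor_add_one (n * phi)
  set k := ⌊n * phi⌋
  by_cases h₁ : n * phi - k < 2 - phi
  · exact .inl (mem_upperWythoff_of_fract (by omega) k (by linarith) h₁)
  by_cases h₂ : n * phi - k < phi - 1
  · refine .inr (.inl (mem_upperWythoff_of_fract (by omega) (k - 3) ?_ ?_)) <;>
      rw [Nat.cast_sub (by omega)] <;> push_cast <;> linarith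
  by_cases h₃ : n * phi - k < 3 * phi - 4
  · refine .inr (.inr (.inl (mem_upperWythoff_of_fract (by omega) (k - 6) ?_ ?_))) <;>
      rw [Nat.cast_sub (by omega)] <;> push_cast <;> linarith
  · refine .inr (.inr (.inr (mem_upperWythoff_of_fract (by omega) (k - 22) ?_ ?_))) <;>
      rw [Nat.cast_sub (by omega)] <;> push_cast <;> linarith

/-- Theorem 3.8(iii): `U₀ + U₀ + U = ℕ \ {0, 1, 3, 8}`. -/
theorem upper0_add_upper0_add_upper (n : ℕ) :
    (∃ a ∈ upperWythoff ∪ {0}, ∃ b ∈ upperWythoff ∪ {0}, ∃ c ∈ upperWythoff,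
        n = a + b + c) ↔
      n ∉ ({0, 1, 3, 8} : Set ℕ) := by
  simp only [Set.mem_insert_iff, Set.mem_singleton_iff]
  constructor
  · rintro ⟨a, ha, b, hb, c, hc, rfl⟩
    have hc' := eq_or_ten_le_of_mem_upperWythoff hc
    have ha' := ha.imp_left eq_or_ten_le_of_mem_upperWythoff
    have hb' := hb.imp_left eq_or_ten_le_of_mem_upperWythoff
    simp only [Set.mem_singleton_iff] at ha' hb'
    omega
  · intro hn
    have h0 : 0 ∈ upperWythoff ∪ {0} := .inr rfl
    have h2 := two_mem_upperWythoff
    have h5 := five_mem_upperWythoff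
    have h7 := seven_mem_upperWythoff
    rcases lt_or_ge n 15 with h | h
    · interval_cases n
      any_goals omega
      · exact ⟨0, h0, 0, h0, 2, h2, rfl⟩
      · exact ⟨0, h0, 2, .inl h2, 2, h2, rfl⟩
      · exact ⟨0, h0, 0, h0, 5, h5, rfl⟩
      · exact ⟨2, .inl h2, 2, .inl h2, 2, h2, rfl⟩
      · exact ⟨0, h0, 0, h0, 7, h7, rfl⟩
      · exact ⟨0, h0, 2, .inl h2, 7, h7, rfl⟩
      · exact ⟨0, h0, 5, .inl h5, 5, h5, rfl⟩
      · exact ⟨2, .inl h2, 2, .inl h2, 7, h7, rfl⟩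
      · exact ⟨0, h0, 5, .inl h5, 7, h7, rfl⟩
      · exact ⟨0, h0, 0, h0, 13, thirteen_mem_upperWythoff, rfl⟩
      · exact ⟨0, h0, 7, .inl h7, 7, h7, rfl⟩
    · rcases exists_sub_mem_upperWythoff h with hu | hu | hu | hu
      · exact ⟨0, h0, 0, h0, n, hu, by omega⟩
      · exact ⟨0, h0, 2, .inl h2, n - 2, hu, by omega⟩
      · exact ⟨2, .inl h2, 2, .inl h2, n - 4, hu, by omega⟩
      · exact ⟨7, .inl h7, 7, .inl h7, n - 14, hu, by omega⟩
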